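/- arXiv:1109.3057 — 4 statements merged into one kernel-verified Lean document; each statement's English description precedes it below -/
import Mathlib

section
/- For all real numbers x, y ≥ 0, (1 - exp(-√(xy)))² ≥ (1 - exp(-x))·(1 - exp(-y)); that is, the function x ↦ 1 - exp(-x) is geometrically concave on [0,∞). -/
lemma aux_exp_slope {a b : ℝ} (ha : 0 < a) (hab : a ≤ b) :
    b * (Real.exp a - 1) ≤ a * (Real.exp b - 1) := by
  have hb : 0 < b := lt_of_lt_of_le ha hab
  have h1 : 0 ≤ 1 - a / b := by
    rw [sub_nonneg, div_le_one hb]; exact hab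
  have h := convexOn_exp.2 (Set.mem_univ b) (Set.mem_univ 0)
    (div_nonneg ha.le hb.le) h1 (by ring)
  have e : a / b * b = a := by field_simp
  simp only [smul_eq_mul, mul_zero, add_zero, Real.exp_zero, mul_one, e] at h
  have h2 := mul_le_mul_of_nonneg_left h hb.le
  have e2 : b * (a / b * Real.exp b + (1 - a / b)) = a * Real.exp b + (b - a) := by
    field_simp
  rw [e2] at h2
  linarith

lemma aux_pos {u : ℝ} (hu : 0 < u) : 0 < 1 - Real.exp (-u) := by
  have : Real.exp (-u) < 1 := by rw [Real.exp_lt_one_iff]; linarith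
  linarith

lemma aux_hasDeriv (t : ℝ) :
    HasDerivAt (fun t : ℝ => Real.log (1 - Real.exp (-Real.exp t)))
      (Real.exp t / (Real.exp (Real.exp t) - 1)) t := by
  have hp := aux_pos (Real.exp_pos t)
  have h := (((Real.hasDerivAt_exp t).neg.exp).const_sub 1).log hp.ne'
  refine HasDerivAt.congr_deriv h ?_
  have h3 : 0 < Real.exp (Real.exp t) - 1 := by
    have := Real.add_one_lt_exp (Real.exp_pos t).ne'
    linarith [Real.exp_pos t]
  simp only [Pi.neg_apply]
  rw [div_eq_div_iff hp.ne' h3.ne']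
  have h4 : Real.exp (-Real.exp t) * Real.exp (Real.exp t) = 1 := by
    rw [← Real.exp_add]; simp
  linear_combination (Real.exp t) * h4

lemma aux_concave :
    ConcaveOn ℝ Set.univ (fun t : ℝ => Real.log (1 - Real.exp (-Real.exp t))) := by
  apply Antitone.concaveOn_univ_of_deriv
  · exact fun t => (aux_hasDeriv t).differentiableAt
  · intro s t hst
    rw [(aux_hasDeriv s).deriv, (aux_hasDeriv t).deriv]
    have hp : ∀ r : ℝ, 0 < Real.exp (Real.exp r) - 1 := fun r => by
      have := Real.add_one_lt_exp (Real.exp_pos r).ne'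
      linarith [Real.exp_pos r]
    rw [div_le_div_iff₀ (hp t) (hp s)]
    exact aux_exp_slope (Real.exp_pos s) (Real.exp_le_exp.2 hst)

/-- The function `x ↦ 1 - exp(-x)` is geometrically concave on `[0,∞)`:
for all `x, y ≥ 0`, `(1 - exp(-√(xy)))² ≥ (1 - exp(-x))·(1 - exp(-y))`. -/
theorem one_sub_exp_neg_geometrically_concave (x y : ℝ) (hx : 0 ≤ x) (hy : 0 ≤ y) :
    (1 - Real.exp (-x)) * (1 - Real.exp (-y)) ≤ (1 - Real.exp (-Real.sqrt (x * y))) ^ 2 := by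
  rcases hx.eq_or_lt with rfl | hx
  · simp
  rcases hy.eq_or_lt with rfl | hy
  · simp
  have hs : 0 < Real.sqrt (x * y) := Real.sqrt_pos.2 (mul_pos hx hy)
  have h := aux_concave.2 (Set.mem_univ (Real.log x)) (Set.mem_univ (Real.log y))
    (by norm_num : (0 : ℝ) ≤ 1 / 2) (by norm_num : (0 : ℝ) ≤ 1 / 2) (by norm_num)
  have e : (1 / 2 : ℝ) * Real.log x + 1 / 2 * Real.log y = Real.log (Real.sqrt (x * y)) := by
    rw [Real.log_sqrt (mul_pos hx hy).le, Real.log_mul hx.ne' hy.ne']; ring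
  simp only [smul_eq_mul, e, Real.exp_log hx, Real.exp_log hy, Real.exp_log hs] at h
  have px := aux_pos hx
  have py := aux_pos hy
  have ps := aux_pos hs
  rw [← Real.log_le_log_iff (mul_pos px py) (pow_pos ps 2), Real.log_mul px.ne' py.ne',
    Real.log_pow]
  push_cast
  linarith
end

section
/- Let μ be a (positive) measure on (0,∞) and let f : [0,∞) → ℝ be given by f(x) = ∫_(0,∞) ((1 - x·t + x²·t²/2) - exp(-x·t))·(1/t²) dμ(t), where this integral is finite for every x ≥ 0. Then for all a, b ≥ 0, f(a+b) - f(a) - f(b) ≥ f(2√(ab)) - 2·f(√(ab)). -/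
open MeasureTheory


theorem aux_slope {x y : ℝ} (hy : 0 < y) (hxy : y ≤ x) :
    x * Real.exp (-x) * (1 - Real.exp (-y)) ≤ y * Real.exp (-y) * (1 - Real.exp (-x)) := by
  have hx : 0 < x := lt_of_lt_of_le hy hxy
  have h1 : x * (Real.exp y - 1) ≤ y * (Real.exp x - 1) := by
    have h := convexOn_exp.2 (Set.mem_univ x) (Set.mem_univ (0 : ℝ))
      (show 0 ≤ y / x by positivity)
      (show 0 ≤ 1 - y / x by
        have : y / x ≤ 1 := (div_le_one hx).2 hxy
        linarith) (by ring)
    simp only [smul_eq_mul, mul_zero, add_zero, Real.exp_zero, mul_one] at h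
    rw [div_mul_cancel₀ _ hx.ne'] at h
    have h2 := mul_le_mul_of_nonneg_left h hx.le
    have h3 : x * (y / x * Real.exp x + (1 - y / x)) = y * Real.exp x + (x - y) := by
      field_simp
    linarith
  have ex : Real.exp x * Real.exp (-x) = 1 := by rw [← Real.exp_add]; simp
  have ey : Real.exp y * Real.exp (-y) = 1 := by rw [← Real.exp_add]; simp
  have h4 := mul_le_mul_of_nonneg_right h1
    (show 0 ≤ Real.exp (-x) * Real.exp (-y) by positivity)
  have e1 : x * (Real.exp y - 1) * (Real.exp (-x) * Real.exp (-y)) =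
      x * Real.exp (-x) * (1 - Real.exp (-y)) := by
    linear_combination x * Real.exp (-x) * ey
  have e2 : y * (Real.exp x - 1) * (Real.exp (-x) * Real.exp (-y)) =
      y * Real.exp (-y) * (1 - Real.exp (-x)) := by
    linear_combination y * Real.exp (-y) * ex
  linarith

theorem aux_anti {s : ℝ} (hs : 0 < s) :
    AntitoneOn (fun r : ℝ => (1 - Real.exp (-(s * r))) * (1 - Real.exp (-(s / r))))
      (Set.Ici 1) := by
  have hd : ∀ r : ℝ, 1 ≤ r →
      HasDerivAt (fun r : ℝ => (1 - Real.exp (-(s * r))) * (1 - Real.exp (-(s / r))))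
        (s * Real.exp (-(s * r)) * (1 - Real.exp (-(s / r)))
          - s / r ^ 2 * Real.exp (-(s / r)) * (1 - Real.exp (-(s * r)))) r := by
    intro r hr
    have hr0 : r ≠ 0 := by positivity
    have h1 : HasDerivAt (fun r : ℝ => 1 - Real.exp (-(s * r)))
        (-(Real.exp (-(s * r)) * (-(s * 1)))) r :=
      ((((hasDerivAt_id r).const_mul s).neg).exp).const_sub 1
    have h2 : HasDerivAt (fun r : ℝ => 1 - Real.exp (-(s / r)))
        (-(Real.exp (-(s / r)) * (-(s * (-(r ^ 2)⁻¹))))) r := by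
      have := ((((hasDerivAt_inv hr0).const_mul s).neg).exp).const_sub 1
      simp only [div_eq_mul_inv]
      exact this
    refine (h1.mul h2).congr_deriv ?_
    field_simp
    ring
  apply antitoneOn_of_deriv_nonpos (convex_Ici 1)
  · exact fun r hr => (hd r hr).continuousAt.continuousWithinAt
  · intro r hr
    rw [interior_Ici] at hr
    exact (hd r (le_of_lt hr)).differentiableAt.differentiableWithinAt
  · intro r hr
    rw [interior_Ici] at hr
    have hr1 : 1 ≤ r := le_of_lt hr
    have hr0 : 0 < r := by linarith
    rw [(hd r hr1).deriv]
    have h := aux_slope (x := s * r) (y := s / r) (by positivity) (by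
      rw [div_le_iff₀ hr0]; nlinarith [mul_le_mul hr1 hr1 zero_le_one hr0.le])
    have h2 : r * (s * Real.exp (-(s * r)) * (1 - Real.exp (-(s / r)))
          - s / r ^ 2 * Real.exp (-(s / r)) * (1 - Real.exp (-(s * r)))) =
        s * r * Real.exp (-(s * r)) * (1 - Real.exp (-(s / r)))
          - s / r * Real.exp (-(s / r)) * (1 - Real.exp (-(s * r))) := by
      field_simp
    by_contra hc
    have := mul_pos hr0 (not_le.1 hc)
    linarith

theorem aux_main {x y s : ℝ} (hy : 0 ≤ y) (hxy : y ≤ x) (hs0 : 0 ≤ s) (hs : s ^ 2 = x * y) :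
    (1 - Real.exp (-x)) * (1 - Real.exp (-y)) ≤ (1 - Real.exp (-s)) ^ 2 := by
  rcases hy.eq_or_lt with rfl | hy
  · simp; positivity
  have hx : 0 < x := lt_of_lt_of_le hy hxy
  have hsp : 0 < s := by
    rcases hs0.eq_or_lt with rfl | h
    · have := mul_pos hx hy
      norm_num at hs
      rcases hs with h | h <;> linarith
    · exact h
  have hsx : s ≤ x := by
    by_contra hc
    nlinarith
  have h1 : 1 ≤ x / s := (one_le_div hsp).2 hsx
  have h := aux_anti hsp (Set.mem_Ici.2 le_rfl) (Set.mem_Ici.2 h1) h1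
  have e1 : s * (x / s) = x := by field_simp
  have e2 : s / (x / s) = y := by
    field_simp
    linarith
  simp only [e1, e2, mul_one, div_one] at h
  rw [sq]
  exact h

theorem aux_main' {x y s : ℝ} (hx : 0 ≤ x) (hy : 0 ≤ y) (hs0 : 0 ≤ s) (hs : s ^ 2 = x * y) :
    (1 - Real.exp (-x)) * (1 - Real.exp (-y)) ≤ (1 - Real.exp (-s)) ^ 2 := by
  rcases le_total y x with h | h
  · exact aux_main hy h hs0 hs
  · rw [mul_comm]
    exact aux_main hx h hs0 (by rw [hs, mul_comm])

/-- If `f` belongs to the class `BF2`, i.e.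
`f x = ∫_(0,∞) ((1 - x·t + x²·t²/2) - exp(-x·t))·(1/t²) dμ(t)` for a positive measure `μ`
on `(0,∞)` (the integral being finite for every `x ≥ 0`), then for all `a, b ≥ 0`,
`f(a+b) - f(a) - f(b) ≥ f(2√(ab)) - 2·f(√(ab))`. -/
theorem bf2_kernel_inequality (μ : Measure ℝ) (f : ℝ → ℝ)
    (hint : ∀ x ≥ 0,
      IntegrableOn
        (fun t => ((1 - x * t + x ^ 2 * t ^ 2 / 2) - Real.exp (-(x * t))) * (1 / t ^ 2))
        (Set.Ioi 0) μ)
    (hf : ∀ x ≥ 0, f x = ∫ t in Set.Ioi (0 : ℝ),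
      ((1 - x * t + x ^ 2 * t ^ 2 / 2) - Real.exp (-(x * t))) * (1 / t ^ 2) ∂μ)
    (a b : ℝ) (ha : 0 ≤ a) (hb : 0 ≤ b) :
    f (a + b) - f a - f b ≥ f (2 * Real.sqrt (a * b)) - 2 * f (Real.sqrt (a * b)) := by
  have hs0 : 0 ≤ Real.sqrt (a * b) := Real.sqrt_nonneg _
  have hs : Real.sqrt (a * b) ^ 2 = a * b := Real.sq_sqrt (by positivity)
  generalize Real.sqrt (a * b) = s at hs0 hs
  have iab := hint (a + b) (by positivity)
  have ia := hint a ha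
  have ib := hint b hb
  have i2 := hint (2 * s) (by positivity)
  have i1 := hint s hs0
  rw [hf (a + b) (by positivity), hf a ha, hf b hb, hf (2 * s) (by positivity), hf s hs0, ge_iff_le,
    ← integral_const_mul, ← integral_sub i2 (i1.const_mul 2), ← integral_sub iab ia,
    ← integral_sub ?_ ib]
  swap
  · exact iab.sub ia
  apply setIntegral_mono_on (i2.sub (i1.const_mul 2)) ((iab.sub ia).sub ib) measurableSet_Ioi
  intro t ht
  have ht : 0 < t := ht
  have h := aux_main' (x := a * t) (y := b * t) (s := s * t) (by positivity) (by positivity)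
    (by positivity) (by linear_combination t ^ 2 * hs)
  have e1 : Real.exp (-((a + b) * t)) = Real.exp (-(a * t)) * Real.exp (-(b * t)) := by
    rw [← Real.exp_add]; ring_nf
  have e2 : Real.exp (-(2 * s * t)) = Real.exp (-(s * t)) * Real.exp (-(s * t)) := by
    rw [← Real.exp_add]; ring_nf
  simp only [Pi.sub_apply]
  rw [e1, e2]
  have h2 := mul_le_mul_of_nonneg_right h (show 0 ≤ 1 / t ^ 2 by positivity)
  have h3 : s ^ 2 * t ^ 2 * (1 / t ^ 2) = a * b * t ^ 2 * (1 / t ^ 2) := by rw [hs]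
  linarith
end

section
/- Let A and B be positive semidefinite n×n complex matrices and let q be a real number with 0 < q ≤ 1 or 2 ≤ q ≤ 3. Then Tr((A+B)^q) - Tr(A^q) - Tr(B^q) ≥ (2^q - 2)·Tr(A^{q/2}·B^{q/2}). -/
open ComplexOrder


/-- For a positive semidefinite matrix `M` and `q : ℝ`, the matrix power `M^q`
via the continuous functional calculus (applying `x ↦ x^q` to the eigenvalues). -/
noncomputable def matrixRpow {n : ℕ} (M : Matrix (Fin n) (Fin n) ℂ) (q : ℝ) :
    Matrix (Fin n) (Fin n) ℂ :=
  cfc (fun x : ℝ => x ^ q) M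

section Aux

open Matrix

theorem aux_conv {q y : ℝ} (hq : q ≤ 1 ∨ 2 ≤ q) (hy : 0 < y) (hy1 : y ≤ 1) :
    1 - y ^ q ≤ (1 - y) * (1 + y) ^ (q - 1) := by
  have hc : 0 ≤ (1 - y) / (1 + y) := div_nonneg (by linarith) (by linarith)
  have hk : ConvexOn ℝ Set.univ (fun x : ℝ => (1 - y) / (1 + y) * (1 + y) ^ x + y ^ x) := by
    have h1 := (convexOn_rpow_left (b := 1 + y) (by linarith)).smul hc
    exact h1.add (convexOn_rpow_left hy)
  have e1 : (1 - y) / (1 + y) * (1 + y) ^ (1 : ℝ) + y ^ (1 : ℝ) = 1 := by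
    have : 1 + y ≠ 0 := by positivity
    rw [Real.rpow_one, Real.rpow_one]; field_simp; ring
  have e2 : (1 - y) / (1 + y) * (1 + y) ^ (2 : ℝ) + y ^ (2 : ℝ) = 1 := by
    have : 1 + y ≠ 0 := by positivity
    rw [Real.rpow_two, Real.rpow_two]; field_simp; ring
  have e3 : (1 - y) * (1 + y) ^ (q - 1) = (1 - y) / (1 + y) * (1 + y) ^ q := by
    rw [Real.rpow_sub_one (by positivity)]; field_simp
  rw [e3]
  rcases hq with hq | hq
  · have hl : 0 < 2 - q := by linarith
    have h := hk.2 (Set.mem_univ q) (Set.mem_univ 2) 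
      (by positivity : 0 ≤ 1 / (2 - q)) (by rw [sub_nonneg, div_le_one hl]; linarith : 0 ≤ 1 - 1 / (2 - q)) (by ring)
    have e : (1 / (2 - q)) • q + (1 - 1 / (2 - q)) • (2 : ℝ) = 1 := by
      simp only [smul_eq_mul]; field_simp; ring
    rw [e] at h
    simp only [e1, e2, smul_eq_mul] at h
    have : 0 ≤ 1 / (2 - q) * ((1 - y) / (1 + y) * (1 + y) ^ q + y ^ q - 1) := by linarith
    have := nonneg_of_mul_nonneg_right this (by positivity : 0 < 1 / (2 - q))
    linarith
  · have hl : 0 < q - 1 := by linarith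
    have h := hk.2 (Set.mem_univ q) (Set.mem_univ 1) 
      (by positivity : 0 ≤ 1 / (q - 1)) (by rw [sub_nonneg, div_le_one hl]; linarith : 0 ≤ 1 - 1 / (q - 1)) (by ring)
    have e : (1 / (q - 1)) • q + (1 - 1 / (q - 1)) • (1 : ℝ) = 2 := by
      simp only [smul_eq_mul]; field_simp; ring
    rw [e] at h
    simp only [e1, e2, smul_eq_mul] at h
    have : 0 ≤ 1 / (q - 1) * ((1 - y) / (1 + y) * (1 + y) ^ q + y ^ q - 1) := by linarith
    have := nonneg_of_mul_nonneg_right this (by positivity : 0 < 1 / (q - 1))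
    linarith

theorem aux_scalar1 {q y : ℝ} (hq0 : 0 < q) (hq : q ≤ 1 ∨ 2 ≤ q) (hy : 0 < y) (hy1 : y ≤ 1) :
    (2 ^ q - 2) * y ^ (q / 2) ≤ (1 + y) ^ q - 1 - y ^ q := by
  let φ : ℝ → ℝ := fun y => ((1 + y) ^ q - 1 - y ^ q) * y ^ (-(q / 2))
  have hd : ∀ x, 0 < x → HasDerivAt φ
      ((1 * q * (1 + x) ^ (q - 1) - q * x ^ (q - 1)) * x ^ (-(q / 2))
        + ((1 + x) ^ q - 1 - x ^ q) * (-(q / 2) * x ^ (-(q / 2) - 1))) x := by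
    intro x hx
    have h1 : HasDerivAt (fun y : ℝ => 1 + y) 1 x := (hasDerivAt_id x).const_add 1
    have h2 := h1.rpow_const (p := q) (Or.inl (by positivity))
    have h3 := Real.hasDerivAt_rpow_const (x := x) (p := q) (Or.inl hx.ne')
    have h4 := Real.hasDerivAt_rpow_const (x := x) (p := -(q / 2)) (Or.inl hx.ne')
    exact ((h2.sub_const 1).sub h3).mul h4
  have hanti : AntitoneOn φ (Set.Ioc 0 1) := by
    apply antitoneOn_of_deriv_nonpos (convex_Ioc 0 1)
    · intro x hx
      exact (hd x hx.1).continuousAt.continuousWithinAt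
    · intro x hx
      rw [interior_Ioc] at hx
      exact (hd x hx.1).differentiableAt.differentiableWithinAt
    · intro x hx
      rw [interior_Ioc] at hx
      have hx0 := hx.1
      rw [(hd x hx.1).deriv]
      have h := aux_conv hq hx.1 hx.2.le
      have e1 : x ^ (-(q / 2)) = x * x ^ (-(q / 2) - 1) := by
        rw [Real.rpow_sub_one hx0.ne']; field_simp
      have e2 : x * x ^ (q - 1) = x ^ q := by
        rw [Real.rpow_sub_one hx0.ne']; field_simp
      have e3 : (1 + x) ^ q = (1 + x) * (1 + x) ^ (q - 1) := by
        rw [Real.rpow_sub_one (by positivity)]; field_simp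
      have hp : 0 < x ^ (-(q / 2) - 1) := Real.rpow_pos_of_pos hx0 _
      rw [e1]
      have : (1 * q * (1 + x) ^ (q - 1) - q * x ^ (q - 1)) * (x * x ^ (-(q / 2) - 1))
        + ((1 + x) ^ q - 1 - x ^ q) * (-(q / 2) * x ^ (-(q / 2) - 1))
        = (q / 2) * x ^ (-(q / 2) - 1) * (1 - x ^ q - (1 - x) * (1 + x) ^ (q - 1)) := by
        rw [e3, ← e2]; ring
      rw [this]
      exact mul_nonpos_of_nonneg_of_nonpos (by positivity) (by linarith)
  have h := hanti ⟨hy, hy1⟩ ⟨one_pos, le_refl _⟩ hy1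
  simp only [φ, Real.one_rpow, mul_one] at h
  have hp : 0 < y ^ (q / 2) := Real.rpow_pos_of_pos hy _
  rw [Real.rpow_neg hy.le, ← div_eq_mul_inv, le_div_iff₀ hp] at h
  norm_num at h
  linarith

theorem aux_scalar {q a b : ℝ} (hq0 : 0 < q) (hq : q ≤ 1 ∨ 2 ≤ q) (ha : 0 ≤ a) (hb : 0 ≤ b) :
    (2 ^ q - 2) * (a ^ (q / 2) * b ^ (q / 2)) ≤ (a + b) ^ q - a ^ q - b ^ q := by
  wlog hab : a ≤ b generalizing a b
  · have := this hb ha (le_of_not_ge hab)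
    rw [add_comm a b, mul_comm (a ^ (q / 2))]; linarith
  rcases ha.eq_or_lt with rfl | ha'
  · rw [Real.zero_rpow (by positivity), Real.zero_rpow (by positivity)]; simp
  have hb' : 0 < b := lt_of_lt_of_le ha' hab
  have h := aux_scalar1 hq0 hq (y := a / b) (by positivity) ((div_le_one hb').2 hab)
  have e1 : (1 + a / b) ^ q = (a + b) ^ q / b ^ q := by
    rw [← Real.div_rpow (by positivity) hb]; congr 1; field_simp; ring
  rw [e1, Real.div_rpow ha hb, Real.div_rpow ha hb] at h
  have hbq : b ^ q = b ^ (q / 2) * b ^ (q / 2) := by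
    rw [← Real.rpow_add hb']; congr 1; ring
  have hp : 0 < b ^ (q / 2) := Real.rpow_pos_of_pos hb' _
  have h2 := mul_le_mul_of_nonneg_right h (by positivity : 0 ≤ b ^ q)
  rw [hbq] at h2 ⊢
  field_simp at h2
  linarith

theorem aux_int {κ : Type*} [Fintype κ] (v x : κ → ℝ) (hx : ∀ k, 0 ≤ x k)
    (h : ∀ s : ℝ, 0 < s → 0 ≤ ∑ k, v k * (x k / (s + x k))) {p : ℝ} (hp : p ∈ Set.Ioo (0 : ℝ) 1) :
    0 ≤ ∑ k, v k * x k ^ p := by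
  have e : ∑ k, v k * x k ^ p = (∫ t in Set.Ioi 0, Real.rpowIntegrand₀₁ p t 1)⁻¹ *
      ∫ t in Set.Ioi 0, ∑ k, v k * Real.rpowIntegrand₀₁ p t (x k) := by
    rw [MeasureTheory.integral_finsetSum]
    · rw [Finset.mul_sum]
      refine Finset.sum_congr rfl fun k _ => ?_
      rw [MeasureTheory.integral_const_mul, Real.rpow_eq_const_mul_integral hp (hx k)]
      ring
    · intro k _
      exact (Real.integrableOn_rpowIntegrand₀₁_Ioi hp (hx k)).const_mul _
  rw [e]
  refine mul_nonneg (inv_nonneg.2 (Real.integral_rpowIntegrand₀₁_one_pos hp).le) ?_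
  refine MeasureTheory.setIntegral_nonneg measurableSet_Ioi fun t ht => ?_
  have ht' : 0 < t := ht
  have : ∑ k, v k * Real.rpowIntegrand₀₁ p t (x k)
      = t ^ (p - 1) * ∑ k, v k * (x k / (t + x k)) := by
    rw [Finset.mul_sum]
    refine Finset.sum_congr rfl fun k _ => ?_
    rw [Real.rpowIntegrand₀₁_eq_pow_div hp ht'.le (hx k)]
    ring
  rw [this]
  exact mul_nonneg (by positivity) (h t ht')

noncomputable def auxW {n : ℕ} {A B : Matrix (Fin n) (Fin n) ℂ} (hA : A.IsHermitian)
    (hB : B.IsHermitian) (i j : Fin n) : ℝ :=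
  Complex.normSq ((star (hA.eigenvectorUnitary : Matrix (Fin n) (Fin n) ℂ) *
    (hB.eigenvectorUnitary : Matrix (Fin n) (Fin n) ℂ)) i j)

theorem aux_cfc {n : ℕ} {A : Matrix (Fin n) (Fin n) ℂ} (hA : A.IsHermitian) (f : ℝ → ℝ) :
    cfc f A = (hA.eigenvectorUnitary : Matrix (Fin n) (Fin n) ℂ) *
      diagonal (fun i => (f (hA.eigenvalues i) : ℂ)) *
      star (hA.eigenvectorUnitary : Matrix (Fin n) (Fin n) ℂ) := by
  rw [hA.cfc_eq]; rfl

theorem aux_trace {n : ℕ} {A : Matrix (Fin n) (Fin n) ℂ} (hA : A.IsHermitian) (f : ℝ → ℝ) :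
    (cfc f A).trace = ((∑ i, f (hA.eigenvalues i) : ℝ) : ℂ) := by
  rw [aux_cfc hA, Matrix.trace_mul_cycle, Unitary.coe_star_mul_self, one_mul, Matrix.trace_diagonal]
  push_cast; rfl

theorem aux_trace_gen {n : ℕ} (U V : Matrix (Fin n) (Fin n) ℂ) (g : Fin n → Fin n → ℝ) :
    (U * Matrix.of (fun i j => (star U * V) i j * (g i j : ℂ)) * star V).trace =
      ((∑ i, ∑ j, Complex.normSq ((star U * V) i j) * g i j : ℝ) : ℂ) := by
  rw [Matrix.trace_mul_cycle, Matrix.trace_mul_comm, Matrix.trace]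
  push_cast
  refine Finset.sum_congr rfl fun i _ => ?_
  rw [Matrix.diag_apply, Matrix.mul_apply]
  refine Finset.sum_congr rfl fun j _ => ?_
  have : (star V * U) j i = star ((star U * V) i j) := by
    rw [← Matrix.star_apply, star_mul, star_star]
  rw [this, Matrix.of_apply, Complex.normSq_eq_conj_mul_self]
  simp only [RCLike.star_def]
  ring

theorem aux_trace2 {n : ℕ} {A B : Matrix (Fin n) (Fin n) ℂ} (hA : A.IsHermitian)
    (hB : B.IsHermitian) (f g : ℝ → ℝ) :
    (cfc f A * cfc g B).trace =
      ((∑ i, ∑ j, auxW hA hB i j * (f (hA.eigenvalues i) * g (hB.eigenvalues j)) : ℝ) : ℂ) := by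
  rw [show (∑ i, ∑ j, auxW hA hB i j * (f (hA.eigenvalues i) * g (hB.eigenvalues j)))
    = _ from rfl]
  unfold auxW
  rw [← aux_trace_gen, aux_cfc hA, aux_cfc hB]
  congr 1
  set U := (hA.eigenvectorUnitary : Matrix (Fin n) (Fin n) ℂ)
  set V := (hB.eigenvectorUnitary : Matrix (Fin n) (Fin n) ℂ)
  have : Matrix.of (fun i j => (star U * V) i j *
      ((f (hA.eigenvalues i) * g (hB.eigenvalues j) : ℝ) : ℂ)) =
      diagonal (fun i => (f (hA.eigenvalues i) : ℂ)) * (star U * V) *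
      diagonal (fun i => (g (hB.eigenvalues i) : ℂ)) := by
    ext i j
    rw [Matrix.mul_diagonal, Matrix.diagonal_mul, Matrix.of_apply]
    push_cast; ring
  rw [this]
  simp only [mul_assoc]

theorem aux_trX {n : ℕ} (A B R X : Matrix (Fin n) (Fin n) ℂ) (hA : A.PosSemidef)
    (hB : B.PosSemidef) (hR : Rᴴ = R) (hRC : R * (A + B) = 1) (hX : A * X + X * B = 1) :
    R.trace ≤ Xᴴ.trace := by
  have h1 := (hA.conjTranspose_mul_mul_same (R - X)).trace_nonneg
  have h2 := (hB.mul_mul_conjTranspose_same (R - X)).trace_nonneg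
  have hX' : Xᴴ * A + B * Xᴴ = 1 := by
    have := congrArg conjTranspose hX
    simpa [conjTranspose_add, conjTranspose_mul, hA.1.eq, hB.1.eq] using this
  have key : ((R - X)ᴴ * A * (R - X)).trace + ((R - X) * B * (R - X)ᴴ).trace
      = Xᴴ.trace - R.trace := by
    have t1 : (R * A * R).trace + (R * B * R).trace = R.trace := by
      rw [← trace_add, ← add_mul, ← mul_add, hRC, one_mul]
    have t2 : (Xᴴ * A * X).trace + (X * B * Xᴴ).trace = Xᴴ.trace := by
      rw [trace_mul_comm (X * B), mul_assoc, ← trace_add, ← mul_add, hX, mul_one]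
    have t3 : (R * A * X).trace + (X * B * R).trace = R.trace := by
      rw [trace_mul_comm (X * B), mul_assoc, ← trace_add, ← mul_add, hX, mul_one]
    have t4 : (Xᴴ * A * R).trace + (R * B * Xᴴ).trace = R.trace := by
      rw [mul_assoc R, trace_mul_comm R, ← trace_add, ← add_mul, hX', one_mul]
    simp only [conjTranspose_sub, hR, sub_mul, mul_sub, trace_sub]
    linear_combination t1 + t2 - t3 - t4
  have := add_nonneg h1 h2
  rw [key] at this
  exact sub_nonneg.1 this

theorem aux_resolvent {n : ℕ} {A B : Matrix (Fin n) (Fin n) ℂ} (hA : A.PosSemidef)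
    (hB : B.PosSemidef) (hC : (A + B).IsHermitian) {s : ℝ} (hs : 0 < s) :
    ∑ k, (s + hC.eigenvalues k)⁻¹ ≤
      ∑ i, ∑ j, auxW hA.1 hB.1 i j * (s + (hA.1.eigenvalues i + hB.1.eigenvalues j))⁻¹ := by
  have hC' : (A + B).PosSemidef := hA.add hB
  set U := (hA.1.eigenvectorUnitary : Matrix (Fin n) (Fin n) ℂ) with hU
  set V := (hB.1.eigenvectorUnitary : Matrix (Fin n) (Fin n) ℂ) with hV
  set W := (hC.eigenvectorUnitary : Matrix (Fin n) (Fin n) ℂ) with hW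
  have hUU : U * star U = 1 := Unitary.coe_mul_star_self _
  have hUU' : star U * U = 1 := Unitary.coe_star_mul_self _
  have hVV : V * star V = 1 := Unitary.coe_mul_star_self _
  have hVV' : star V * V = 1 := Unitary.coe_star_mul_self _
  have hWW : W * star W = 1 := Unitary.coe_mul_star_self _
  have hWW' : star W * W = 1 := Unitary.coe_star_mul_self _
  set g : Fin n → Fin n → ℝ := fun i j => (s + (hA.1.eigenvalues i + hB.1.eigenvalues j))⁻¹
  set Y : Matrix (Fin n) (Fin n) ℂ := Matrix.of (fun i j => (star U * V) i j * (g i j : ℂ)) with hY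
  have sA : A = U * diagonal (fun i => (hA.1.eigenvalues i : ℂ)) * star U := hA.1.spectral_theorem
  have sB : B = V * diagonal (fun i => (hB.1.eigenvalues i : ℂ)) * star V := hB.1.spectral_theorem
  have sC : A + B = W * diagonal (fun i => (hC.eigenvalues i : ℂ)) * star W := hC.spectral_theorem
  have hs2 : ((s / 2 : ℝ) : ℂ) ≥ 0 := by
    rw [ge_iff_le, Complex.zero_le_real]; positivity
  have hone : (((s / 2 : ℝ) : ℂ) • (1 : Matrix (Fin n) (Fin n) ℂ)).PosSemidef :=
    PosSemidef.one.smul hs2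
  have hsum : A + ((s / 2 : ℝ) : ℂ) • 1 + (B + ((s / 2 : ℝ) : ℂ) • 1) = (A + B) + (s : ℂ) • 1 := by
    have : (s : ℂ) = ((s / 2 : ℝ) : ℂ) + ((s / 2 : ℝ) : ℂ) := by push_cast; ring
    rw [this, add_smul]; abel
  have key := aux_trX (A + ((s / 2 : ℝ) : ℂ) • 1) (B + ((s / 2 : ℝ) : ℂ) • 1)
    (W * diagonal (fun i => ((s + hC.eigenvalues i)⁻¹ : ℝ) : Fin n → ℂ) * star W)
    (U * Y * star V) (hA.add hone) (hB.add hone) ?_ ?_ ?_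
  · rw [trace_conjTranspose, hY, aux_trace_gen, trace_mul_cycle, hWW', one_mul,
      trace_diagonal, RCLike.star_def, Complex.conj_ofReal, ← Complex.ofReal_sum,
      Complex.real_le_real] at key
    exact key
  · simp only [conjTranspose_mul, star_eq_conjTranspose, conjTranspose_conjTranspose,
      diagonal_conjTranspose, mul_assoc]
    congr 3
    ext i
    simp
  · have hC2 : (A + B) + (s : ℂ) • (1 : Matrix (Fin n) (Fin n) ℂ) =
        W * diagonal (fun i => (hC.eigenvalues i : ℂ)) * star W + (s : ℂ) • 1 :=
      congrArg (· + (s : ℂ) • (1 : Matrix (Fin n) (Fin n) ℂ)) sC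
    rw [hsum, hC2]
    have : (s : ℂ) • (1 : Matrix (Fin n) (Fin n) ℂ) = W * diagonal (fun _ => (s : ℂ)) * star W := by
      rw [← smul_one_eq_diagonal, Matrix.mul_smul, Matrix.smul_mul, mul_one, hWW]
    rw [this, ← add_mul, ← mul_add, diagonal_add]
    calc _ = W * diagonal (fun i => ((s + hC.eigenvalues i)⁻¹ : ℝ) : Fin n → ℂ) * (star W * W) *
          diagonal (fun i => (hC.eigenvalues i : ℂ) + (s : ℂ)) * star W := by
            simp only [mul_assoc]
      _ = 1 := by
        rw [hWW', mul_one, mul_assoc W, diagonal_mul_diagonal]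
        have : (fun i => (((s + hC.eigenvalues i)⁻¹ : ℝ) : ℂ) *
            ((hC.eigenvalues i : ℂ) + (s : ℂ))) = fun _ => 1 := by
          ext i
          have h0 : s + hC.eigenvalues i ≠ 0 := by
            have := hC'.eigenvalues_nonneg i
            positivity
          rw [← Complex.ofReal_add, ← Complex.ofReal_mul, add_comm _ s, inv_mul_cancel₀ h0]
          simp
        rw [this, diagonal_one, mul_one, hWW]
  · have e1 : A * (U * Y * star V) =
        U * (diagonal (fun i => (hA.1.eigenvalues i : ℂ)) * Y) * star V := by
      calc _ = (U * diagonal (fun i => (hA.1.eigenvalues i : ℂ)) * star U) * (U * Y * star V) := by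
            rw [← sA]
        _ = U * diagonal (fun i => (hA.1.eigenvalues i : ℂ)) * (star U * U) * Y * star V := by
            simp only [mul_assoc]
        _ = _ := by rw [hUU', mul_one]; simp only [mul_assoc]
    have e2 : (U * Y * star V) * B =
        U * (Y * diagonal (fun i => (hB.1.eigenvalues i : ℂ))) * star V := by
      calc _ = (U * Y * star V) * (V * diagonal (fun i => (hB.1.eigenvalues i : ℂ)) * star V) := by
            rw [← sB]
        _ = U * Y * (star V * V) * diagonal (fun i => (hB.1.eigenvalues i : ℂ)) * star V := by
            simp only [mul_assoc]
        _ = _ := by rw [hVV', mul_one]; simp only [mul_assoc]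
    have e3 : diagonal (fun i => (hA.1.eigenvalues i : ℂ)) * Y +
        Y * diagonal (fun i => (hB.1.eigenvalues i : ℂ)) + (s : ℂ) • Y = star U * V := by
      ext i j
      rw [Matrix.add_apply, Matrix.add_apply, Matrix.smul_apply, Matrix.mul_diagonal,
        Matrix.diagonal_mul, hY, Matrix.of_apply, smul_eq_mul]
      have h0 : s + (hA.1.eigenvalues i + hB.1.eigenvalues j) ≠ 0 := by
        have := hA.eigenvalues_nonneg i
        have := hB.eigenvalues_nonneg j
        positivity
      have h1 : ((s : ℂ) + (hA.1.eigenvalues i + hB.1.eigenvalues j)) * (g i j : ℂ) = 1 := by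
        rw [← Complex.ofReal_add, ← Complex.ofReal_add, ← Complex.ofReal_mul, mul_inv_cancel₀ h0]
        simp
      linear_combination (star U * V) i j * h1
    have e4 : (s : ℂ) • (U * Y * star V) = U * ((s : ℂ) • Y) * star V := by
      rw [Matrix.mul_smul, Matrix.smul_mul]
    have e5 : (s : ℂ) = ((s / 2 : ℝ) : ℂ) + ((s / 2 : ℝ) : ℂ) := by push_cast; ring
    calc _ = A * (U * Y * star V) + (U * Y * star V) * B + (s : ℂ) • (U * Y * star V) := by
          rw [e5, add_smul, add_mul, mul_add, Matrix.smul_mul, Matrix.mul_smul, one_mul, mul_one]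
          abel
      _ = U * (star U * V) * star V := by
          rw [e1, e2, e4, ← add_mul, ← add_mul, ← mul_add, ← mul_add, e3]
      _ = 1 := by rw [← mul_assoc, hUU, one_mul, hVV]

theorem aux_pow {n : ℕ} {A B : Matrix (Fin n) (Fin n) ℂ} (hA : A.IsHermitian)
    (hB : B.IsHermitian) (k l : ℕ) :
    (A ^ k * B ^ l).trace =
      ((∑ i, ∑ j, auxW hA hB i j * (hA.eigenvalues i ^ k * hB.eigenvalues j ^ l) : ℝ) : ℂ) := by
  rw [← aux_trace2 hA hB (fun x => x ^ k) (fun x => x ^ l),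
    cfc_pow_id (R := ℝ) A k hA.isSelfAdjoint, cfc_pow_id (R := ℝ) B l hB.isSelfAdjoint]

theorem aux_powC {n : ℕ} {A : Matrix (Fin n) (Fin n) ℂ} (hA : A.IsHermitian) (k : ℕ) :
    (A ^ k).trace = ((∑ i, hA.eigenvalues i ^ k : ℝ) : ℂ) := by
  rw [← aux_trace hA (fun x => x ^ k), cfc_pow_id (R := ℝ) A k hA.isSelfAdjoint]

theorem aux_moment {n : ℕ} {A B : Matrix (Fin n) (Fin n) ℂ} (hA : A.IsHermitian)
    (hB : B.IsHermitian) (hC : (A + B).IsHermitian) (m : ℕ) (hm : m ≤ 3) :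
    ∑ k, hC.eigenvalues k ^ m =
      ∑ i, ∑ j, auxW hA hB i j * (hA.eigenvalues i + hB.eigenvalues j) ^ m := by
  have h : (((∑ k, hC.eigenvalues k ^ m : ℝ)) : ℂ) = ((∑ i, ∑ j, auxW hA hB i j *
      (hA.eigenvalues i + hB.eigenvalues j) ^ m : ℝ) : ℂ) := by
    rw [← aux_powC]
    interval_cases m
    · have := aux_pow hA hB 0 0
      simpa using this
    · have e : ((A + B) ^ 1).trace = (A ^ 1 * B ^ 0).trace + (A ^ 0 * B ^ 1).trace := by
        simp
      rw [e, aux_pow hA hB, aux_pow hA hB, ← Complex.ofReal_add]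
      simp only [← Finset.sum_add_distrib]
      congr 1
      refine Finset.sum_congr rfl fun i _ => Finset.sum_congr rfl fun j _ => ?_
      ring
    · have e : ((A + B) ^ 2).trace = (A ^ 2 * B ^ 0).trace + (A ^ 1 * B ^ 1).trace +
          (A ^ 1 * B ^ 1).trace + (A ^ 0 * B ^ 2).trace := by
        have := trace_mul_comm A B
        simp only [pow_two, pow_one, pow_zero, mul_one, one_mul, add_mul, mul_add, trace_add]
        linear_combination -this
      rw [e]
      simp only [aux_pow hA hB, ← Complex.ofReal_add, ← Finset.sum_add_distrib]
      congr 1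
      refine Finset.sum_congr rfl fun i _ => Finset.sum_congr rfl fun j _ => ?_
      ring
    · have e : ((A + B) ^ 3).trace = (A ^ 3 * B ^ 0).trace + (A ^ 2 * B ^ 1).trace +
          (A ^ 2 * B ^ 1).trace + (A ^ 2 * B ^ 1).trace + (A ^ 1 * B ^ 2).trace +
          (A ^ 1 * B ^ 2).trace + (A ^ 1 * B ^ 2).trace + (A ^ 0 * B ^ 3).trace := by
        have h1 := trace_mul_comm A (A * B)
        have h2 := trace_mul_comm (A * B) A
        have h3 := trace_mul_comm (A * A) B
        have h4 := trace_mul_comm A (B * B)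
        have h5 := trace_mul_comm (A * B) B
        simp only [mul_assoc] at h1 h2 h3 h4 h5
        simp only [pow_succ, pow_zero, mul_one, one_mul, add_mul, mul_add, trace_add, mul_assoc]
        linear_combination -h1 - h3 - h4 - h5
      rw [e]
      simp only [aux_pow hA hB, ← Complex.ofReal_add, ← Finset.sum_add_distrib]
      congr 1
      refine Finset.sum_congr rfl fun i _ => Finset.sum_congr rfl fun j _ => ?_
      ring
  exact_mod_cast h

theorem aux_L {n : ℕ} {A B : Matrix (Fin n) (Fin n) ℂ} (hA : A.PosSemidef)
    (hB : B.PosSemidef) (hC : (A + B).IsHermitian) {q : ℝ}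
    (hq : (0 < q ∧ q ≤ 1) ∨ (2 ≤ q ∧ q ≤ 3)) :
    ∑ i, ∑ j, auxW hA.1 hB.1 i j * (hA.1.eigenvalues i + hB.1.eigenvalues j) ^ q ≤
      ∑ k, hC.eigenvalues k ^ q := by
  have hC' : (A + B).PosSemidef := hA.add hB
  have hmom := aux_moment hA.1 hB.1 hC
  have hres := fun s hs => aux_resolvent hA hB hC (s := s) hs
  have ha := hA.eigenvalues_nonneg
  have hb := hB.eigenvalues_nonneg
  have hc : ∀ k, 0 ≤ hC.eigenvalues k := hC'.eigenvalues_nonneg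
  generalize hA.1.eigenvalues = a at *
  generalize hB.1.eigenvalues = b at *
  generalize hC.eigenvalues = c at *
  generalize auxW hA.1 hB.1 = w at *
  let v : Fin n ⊕ (Fin n × Fin n) → ℝ := Sum.elim (fun _ => 1) (fun p => - w p.1 p.2)
  let x : Fin n ⊕ (Fin n × Fin n) → ℝ := Sum.elim c (fun p => a p.1 + b p.2)
  have hx : ∀ k, 0 ≤ x k := by
    rintro (k | p)
    · exact hc k
    · exact add_nonneg (ha _) (hb _)
  have hL : ∀ f : ℝ → ℝ, ∑ k, v k * f (x k) =
      ∑ k, f (c k) - ∑ i, ∑ j, w i j * f (a i + b j) := by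
    intro f
    rw [Fintype.sum_sum_type, Fintype.sum_prod_type]
    simp [v, x, sub_eq_add_neg]
  have hM : ∀ m ≤ 3, ∑ k, v k * x k ^ m = 0 := fun m hm => by
    rw [hL (fun t => t ^ m), hmom m hm, sub_self]
  have hR : ∀ s : ℝ, 0 < s → ∑ k, v k * (s + x k)⁻¹ ≤ 0 := fun s hs => by
    rw [hL (fun t => (s + t)⁻¹)]
    have := hres s hs
    linarith
  suffices h : 0 ≤ ∑ k, v k * x k ^ q by
    rw [hL (fun t => t ^ q)] at h
    linarith
  have h0 := hM 0 (by norm_num)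
  have h1 := hM 1 (by norm_num)
  have h2 := hM 2 (by norm_num)
  have h3 := hM 3 (by norm_num)
  rcases hq with ⟨hq0, hq1⟩ | ⟨hq2, hq3⟩
  · rcases hq1.eq_or_lt with rfl | hq1
    · simp only [Real.rpow_one]
      simp only [pow_one] at h1
      exact h1.ge
    · refine aux_int v x hx (fun s hs => ?_) ⟨hq0, hq1⟩
      have e : ∑ k, v k * (x k / (s + x k)) =
          ∑ k, v k * x k ^ 0 - s * ∑ k, v k * (s + x k)⁻¹ := by
        rw [Finset.mul_sum, ← Finset.sum_sub_distrib]
        refine Finset.sum_congr rfl fun k _ => ?_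
        have : s + x k ≠ 0 := by have := hx k; positivity
        field_simp
        ring
      rw [e, h0]
      have := mul_nonpos_of_nonneg_of_nonpos hs.le (hR s hs)
      linarith
  · rcases hq2.eq_or_lt with rfl | hq2
    · simp only [Real.rpow_two]
      exact h2.ge
    rcases hq3.eq_or_lt with rfl | hq3
    · have : ∀ t : ℝ, t ^ (3 : ℝ) = t ^ 3 := fun t => by exact_mod_cast Real.rpow_natCast t 3
      simp only [this]
      exact h3.ge
    have e : ∑ k, v k * x k ^ q = ∑ k, (v k * x k ^ 2) * x k ^ (q - 2) := by
      refine Finset.sum_congr rfl fun k _ => ?_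
      rw [mul_assoc, ← Real.rpow_two, ← Real.rpow_add_of_nonneg (hx k) (by norm_num) (by linarith)]
      congr 2
      ring
    rw [e]
    refine aux_int _ x hx (fun s hs => ?_) ⟨by linarith, by linarith⟩
    have e : ∑ k, v k * x k ^ 2 * (x k / (s + x k)) =
        ∑ k, v k * x k ^ 2 - s * ∑ k, v k * x k ^ 1 + s ^ 2 * ∑ k, v k * x k ^ 0
          - s ^ 3 * ∑ k, v k * (s + x k)⁻¹ := by
      rw [Finset.mul_sum, Finset.mul_sum, Finset.mul_sum, ← Finset.sum_sub_distrib,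
        ← Finset.sum_add_distrib, ← Finset.sum_sub_distrib]
      refine Finset.sum_congr rfl fun k _ => ?_
      have : s + x k ≠ 0 := by have := hx k; positivity
      field_simp
      ring
    rw [e, h0, h1, h2]
    have := mul_nonpos_of_nonneg_of_nonpos (pow_pos hs 3).le (hR s hs)
    linarith

end Aux

/-- Corollary 4.1, first part: for positive semidefinite `A, B` and `0 < q ≤ 1` or
`2 ≤ q ≤ 3`, `Tr((A+B)^q) - Tr(A^q) - Tr(B^q) ≥ (2^q - 2)·Tr(A^{q/2}·B^{q/2})`. -/
theorem trace_rpow_inequality {n : ℕ}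
    (A B : Matrix (Fin n) (Fin n) ℂ) (hA : A.PosSemidef) (hB : B.PosSemidef)
    (q : ℝ) (hq : (0 < q ∧ q ≤ 1) ∨ (2 ≤ q ∧ q ≤ 3)) :
    (matrixRpow (A + B) q).trace - (matrixRpow A q).trace - (matrixRpow B q).trace ≥
      ((2 ^ q - 2 : ℝ) : ℂ) * (matrixRpow A (q / 2) * matrixRpow B (q / 2)).trace := by
  have hC : (A + B).IsHermitian := (hA.add hB).1
  have hq0 : 0 < q := by rcases hq with h | h <;> linarith [h.1]
  have hq' : q ≤ 1 ∨ 2 ≤ q := hq.imp (fun h => h.2) (fun h => h.1)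
  have tA : (matrixRpow A q).trace =
      ((∑ i, ∑ j, auxW hA.1 hB.1 i j * hA.1.eigenvalues i ^ q : ℝ) : ℂ) := by
    have := aux_trace2 hA.1 hB.1 (fun x => x ^ q) (fun _ => 1)
    rw [cfc_const_one ℝ B hB.1.isSelfAdjoint, mul_one] at this
    simpa only [mul_one, matrixRpow] using this
  have tB : (matrixRpow B q).trace =
      ((∑ i, ∑ j, auxW hA.1 hB.1 i j * hB.1.eigenvalues j ^ q : ℝ) : ℂ) := by
    have := aux_trace2 hA.1 hB.1 (fun _ => 1) (fun x => x ^ q)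
    rw [cfc_const_one ℝ A hA.1.isSelfAdjoint, one_mul] at this
    simpa only [one_mul, matrixRpow] using this
  have tC : (matrixRpow (A + B) q).trace = ((∑ k, hC.eigenvalues k ^ q : ℝ) : ℂ) :=
    aux_trace hC _
  have tAB := aux_trace2 hA.1 hB.1 (fun x => x ^ (q / 2)) (fun x => x ^ (q / 2))
  rw [tA, tB, tC, matrixRpow, matrixRpow, tAB, ← Complex.ofReal_sub, ← Complex.ofReal_sub,
    ← Complex.ofReal_mul, ge_iff_le, Complex.real_le_real]
  refine le_trans ?_ (sub_le_sub_right (sub_le_sub_right (aux_L hA hB hC hq) _) _)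
  simp only [Finset.mul_sum, ← Finset.sum_sub_distrib]
  refine Finset.sum_le_sum fun i _ => Finset.sum_le_sum fun j _ => ?_
  have hw : 0 ≤ auxW hA.1 hB.1 i j := Complex.normSq_nonneg _
  have h := mul_le_mul_of_nonneg_left
    (aux_scalar hq0 hq' (hA.eigenvalues_nonneg i) (hB.eigenvalues_nonneg j))
    hw
  linarith
end

section
/- Let A and B be n×n complex matrices and let q be a real number such that either (i) q < 0 and A, B are positive definite, or (ii) 1 ≤ q ≤ 2 and A, B are positive semidefinite. Then Tr((A+B)^q) - Tr(A^q) - Tr(B^q) ≤ (2^q - 2)·Tr(A^{q/2}·B^{q/2}). -/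
open ComplexOrder

section GT
open Matrix
variable {n : ℕ}

lemma gt_trace_pow_comm (X Y : Matrix (Fin n) (Fin n) ℂ) (m : ℕ) :
    ((X * Y) ^ m).trace = ((Y * X) ^ m).trace := by
  cases m with
  | zero => simp
  | succ m =>
    have h : SemiconjBy X (Y * X) (X * Y) := by
      simp [SemiconjBy, mul_assoc]
    have h2 := (h.pow_right m).eq
    rw [pow_succ, ← mul_assoc, ← h2, mul_assoc, trace_mul_comm, pow_succ, mul_assoc]

lemma gt_trace_self_star (Z : Matrix (Fin n) (Fin n) ℂ) : 0 ≤ (Z * Zᴴ).trace.re := by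
  have := (Matrix.posSemidef_self_mul_conjTranspose Z).trace_nonneg
  exact (Complex.le_def.1 this).1

lemma gt_re_star (Z : Matrix (Fin n) (Fin n) ℂ) : (Zᴴ).trace.re = Z.trace.re := by
  simp [trace_conjTranspose]

lemma gt_L0 (Z : Matrix (Fin n) (Fin n) ℂ) : (Z ^ 2).trace.re ≤ (Z * Zᴴ).trace.re := by
  have h := gt_trace_self_star (Z - Zᴴ)
  have e : (Z - Zᴴ) * (Z - Zᴴ)ᴴ = Z * Zᴴ - Z ^ 2 - (Z ^ 2)ᴴ + Zᴴ * Z := by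
    simp [conjTranspose_sub, pow_two]; noncomm_ring
  rw [e, trace_add, trace_sub, trace_sub, trace_mul_comm Zᴴ Z] at h
  have := gt_re_star (Z ^ 2)
  simp only [Complex.add_re, Complex.sub_re] at h
  linarith

lemma gt_two (P Q : Matrix (Fin n) (Fin n) ℂ) (hP : P.IsHermitian) (hQ : Q.IsHermitian) :
    2 * (P * Q).trace.re ≤ (P ^ 2).trace.re + (Q ^ 2).trace.re := by
  have h := gt_trace_self_star (P - Q)
  have e : (P - Q) * (P - Q)ᴴ = P ^ 2 - P * Q - Q * P + Q ^ 2 := by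
    rw [conjTranspose_sub, hP.eq, hQ.eq]; noncomm_ring
  rw [e, trace_add, trace_sub, trace_sub, trace_mul_comm Q P] at h
  simp only [Complex.add_re, Complex.sub_re] at h
  linarith

lemma gt_LC (k : ℕ) :
    (∀ Z : Matrix (Fin n) (Fin n) ℂ,
      (Z ^ (2 ^ (k + 1))).trace.re ≤ ((Z * Zᴴ) ^ (2 ^ k)).trace.re) ∧
    (∀ X Y : Matrix (Fin n) (Fin n) ℂ, X.IsHermitian → Y.IsHermitian →
      ((X * Y) ^ (2 ^ k)).trace.re ≤ (X ^ (2 ^ k) * Y ^ (2 ^ k)).trace.re) := by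
  induction k with
  | zero =>
    refine ⟨fun Z => ?_, fun X Y _ _ => ?_⟩
    · simpa using gt_L0 Z
    · simp
  | succ k ih =>
    obtain ⟨L, C⟩ := ih
    refine ⟨fun Z => ?_, fun X Y hX hY => ?_⟩
    · have h1 := L (Z ^ 2)
      have e1 : Z ^ 2 * (Z ^ 2)ᴴ = Z * (Z * Zᴴ * Zᴴ) := by
        simp [pow_two, mul_assoc]
      rw [e1, gt_trace_pow_comm, ← pow_mul] at h1
      have e2 : Z * Zᴴ * Zᴴ * Z = (Z * Zᴴ) * (Zᴴ * Z) := by simp [mul_assoc]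
      rw [e2] at h1
      have hP := isHermitian_mul_conjTranspose_self Z
      have hQ := isHermitian_conjTranspose_mul_self Z
      have h2 := C _ _ hP hQ
      have h3 := gt_two _ _ (hP.pow (2 ^ k)) (hQ.pow (2 ^ k))
      rw [← pow_mul, ← pow_mul, ← pow_succ, gt_trace_pow_comm Zᴴ Z] at h3
      have e3 : 2 ^ (k + 1 + 1) = 2 * 2 ^ (k + 1) := by ring
      rw [e3]
      linarith
    · have h1 := L (X * Y)
      have e1 : (X * Y) * (X * Y)ᴴ = (X * Y * Y) * X := by
        rw [conjTranspose_mul, hX.eq, hY.eq]; simp [mul_assoc]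
      have e2 : X * (X * Y * Y) = X ^ 2 * Y ^ 2 := by simp [pow_two, mul_assoc]
      rw [e1, gt_trace_pow_comm (X * Y * Y) X, e2] at h1
      have h2 := C _ _ (hX.pow 2) (hY.pow 2)
      rw [← pow_mul, ← pow_mul, ← pow_succ'] at h2
      linarith

end GT

section LT
set_option linter.unusedSectionVars false
open NormedSpace Filter Topology
variable {𝔸 : Type*} [NormedRing 𝔸] [NormedAlgebra ℝ 𝔸] [CompleteSpace 𝔸] [NormOneClass 𝔸]

lemma lt_pow_sub (x y : 𝔸) (M : ℝ) (hM : 1 ≤ M) (hx : ‖x‖ ≤ M) (hy : ‖y‖ ≤ M) (m : ℕ) :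
    ‖x ^ m - y ^ m‖ ≤ m * M ^ m * ‖x - y‖ := by
  induction m with
  | zero => simp
  | succ m ih =>
    have e : x ^ (m + 1) - y ^ (m + 1) = x ^ m * (x - y) + (x ^ m - y ^ m) * y := by
      rw [pow_succ, pow_succ]; noncomm_ring
    have h1 : ‖x ^ m * (x - y)‖ ≤ M ^ (m + 1) * ‖x - y‖ := by
      refine (norm_mul_le _ _).trans ?_
      gcongr
      calc ‖x ^ m‖ ≤ ‖x‖ ^ m := norm_pow_le _ _
        _ ≤ M ^ m := by gcongr
        _ ≤ M ^ (m + 1) := pow_le_pow_right₀ hM (by omega)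
    have h2 : ‖(x ^ m - y ^ m) * y‖ ≤ (m * M ^ m * ‖x - y‖) * M := by
      refine (norm_mul_le _ _).trans ?_
      gcongr
    rw [e]
    refine (norm_add_le _ _).trans ((add_le_add h1 h2).trans (le_of_eq ?_))
    push_cast; ring

lemma lt_norm_exp (x : 𝔸) : ‖exp x‖ ≤ Real.exp ‖x‖ := by
  rw [Real.exp_eq_exp_ℝ, exp_eq_tsum ℝ, exp_eq_tsum ℝ]
  refine (norm_tsum_le_tsum_norm (norm_expSeries_summable' x)).trans ?_
  refine Summable.tsum_le_tsum (fun k => ?_) (norm_expSeries_summable' x)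
    (expSeries_summable' ‖x‖)
  rw [norm_smul, smul_eq_mul, Real.norm_of_nonneg (by positivity)]
  gcongr
  exact norm_pow_le _ _

lemma lt_lie_trotter (H K : 𝔸) :
    Tendsto (fun m : ℕ => (exp ((m : ℝ)⁻¹ • H) * exp ((m : ℝ)⁻¹ • K)) ^ m) atTop
      (𝓝 (exp (H + K))) := by
  set D : ℝ → 𝔸 := fun s => exp (s • H) * exp (s • K) - exp (s • (H + K)) with hD
  have hd : HasDerivAt D 0 0 := by
    have h1 := (hasDerivAt_exp_smul_const (𝕂 := ℝ) H (0:ℝ)).mul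
      (hasDerivAt_exp_smul_const (𝕂 := ℝ) K (0:ℝ))
    have h2 := h1.sub (hasDerivAt_exp_smul_const (𝕂 := ℝ) (H + K) (0:ℝ))
    convert! h2 using 1
    simp
  have hD0 : D 0 = 0 := by simp [hD]
  have hlim : Tendsto (fun m : ℕ => (m : ℝ) * ‖D ((m : ℝ)⁻¹)‖) atTop (𝓝 0) := by
    have h := hd.tendsto_slope_zero
    have h' : Tendsto (fun m : ℕ => ((m : ℝ)⁻¹)) atTop (𝓝[≠] 0) := by
      refine tendsto_nhdsWithin_iff.2 ⟨tendsto_inv_atTop_nhds_zero_nat, ?_⟩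
      filter_upwards [eventually_gt_atTop 0] with m hm
      simp; omega
    have := (h.comp h').norm
    simp only [Function.comp_def, zero_add, hD0, sub_zero, norm_zero, inv_inv, norm_smul] at this
    simpa using this
  rw [tendsto_iff_norm_sub_tendsto_zero]
  set c := ‖H‖ + ‖K‖
  have hlim2 := hlim.const_mul (Real.exp c)
  rw [mul_zero] at hlim2
  refine squeeze_zero' (Eventually.of_forall fun _ => norm_nonneg _) ?_ hlim2
  filter_upwards [eventually_gt_atTop 0] with m hm
  have hm' : (0:ℝ) < m := by exact_mod_cast hm
  have e : exp (H + K) = (exp ((m : ℝ)⁻¹ • (H + K))) ^ m := by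
    let _ : NormedAlgebra ℚ 𝔸 := .restrictScalars ℚ ℝ 𝔸
    rw [← NormedSpace.exp_nsmul, ← Nat.cast_smul_eq_nsmul ℝ, smul_smul, mul_inv_cancel₀ hm'.ne', one_smul]
  rw [e]
  have hi : 0 ≤ (m:ℝ)⁻¹ := by positivity
  have b1 : ∀ x : 𝔸, ‖exp ((m : ℝ)⁻¹ • x)‖ ≤ Real.exp ((m : ℝ)⁻¹ * ‖x‖) := fun x => by
    refine (lt_norm_exp _).trans ?_
    rw [norm_smul, Real.norm_of_nonneg hi]
  have := lt_pow_sub (exp ((m : ℝ)⁻¹ • H) * exp ((m : ℝ)⁻¹ • K)) (exp ((m : ℝ)⁻¹ • (H + K)))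
    (Real.exp ((m : ℝ)⁻¹ * c)) (Real.one_le_exp (by positivity))
    (by
      refine (norm_mul_le _ _).trans ?_
      rw [mul_add, Real.exp_add]
      gcongr
      · exact b1 H
      · exact b1 K)
    (by
      refine (b1 _).trans ?_
      gcongr
      exact norm_add_le _ _) m
  refine this.trans (le_of_eq ?_)
  rw [← Real.exp_nat_mul, ← mul_assoc (m:ℝ) ((m:ℝ)⁻¹), mul_inv_cancel₀ hm'.ne', one_mul]
  simp only [hD]; ring
end LT

section GT2
open Matrix
open NormedSpace Filter Topology
open scoped Matrix.Norms.Operator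

lemma golden_thompson {n : ℕ} (H K : Matrix (Fin n) (Fin n) ℂ) (hH : H.IsHermitian)
    (hK : K.IsHermitian) : (exp (H + K)).trace.re ≤ (exp H * exp K).trace.re := by
  rcases Nat.eq_zero_or_pos n with rfl | hn
  · simp [Matrix.trace]
  have : Nonempty (Fin n) := ⟨⟨0, hn⟩⟩
  have h := lt_lie_trotter H K
  have h2 : Tendsto (fun k : ℕ => 2 ^ k) atTop (atTop : Filter ℕ) :=
    tendsto_pow_atTop_atTop_of_one_lt (by norm_num)
  have h3 := h.comp h2
  have hc : Continuous (fun M : Matrix (Fin n) (Fin n) ℂ => M.trace.re) := by fun_prop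
  have h4 := (hc.tendsto _).comp h3
  refine le_of_tendsto h4 (Eventually.of_forall fun k => ?_)
  have hpow : ∀ X : Matrix (Fin n) (Fin n) ℂ,
      exp X = (exp (((2 ^ k : ℕ) : ℝ)⁻¹ • X)) ^ (2 ^ k) := fun X => by
    have hm' : ((2 ^ k : ℕ) : ℝ) ≠ 0 := by positivity
    rw [← Matrix.exp_nsmul, ← Nat.cast_smul_eq_nsmul ℝ, smul_smul, mul_inv_cancel₀ hm', one_smul]
  have hh : ∀ X : Matrix (Fin n) (Fin n) ℂ, X.IsHermitian →
      (exp (((2 ^ k : ℕ) : ℝ)⁻¹ • X)).IsHermitian := fun X hX => by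
    apply Matrix.IsHermitian.exp
    unfold Matrix.IsHermitian
    rw [conjTranspose_smul, hX.eq]; simp
  have := (gt_LC k).2 _ _ (hh H hH) (hh K hK)
  rw [← hpow, ← hpow] at this
  exact this
end GT2

section Scalar
open MeasureTheory Set Filter Topology

lemma sc_exp_slope {x y : ℝ} (hy : 0 < y) (hxy : y ≤ x) :
    x * (Real.exp y - 1) ≤ y * (Real.exp x - 1) := by
  have hx : 0 < x := hy.trans_le hxy
  have ht0 : 0 ≤ y / x := by positivity
  have ht1 : 0 ≤ 1 - y / x := by rw [sub_nonneg, div_le_one hx]; exact hxy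
  have h := convexOn_exp.2 (mem_univ x) (mem_univ 0) ht0 ht1 (by ring)
  simp only [smul_eq_mul, mul_zero, add_zero, Real.exp_zero, mul_one] at h
  rw [div_mul_cancel₀ _ hx.ne'] at h
  have h2 := mul_le_mul_of_nonneg_left h hx.le
  have e : x * (y / x * Real.exp x + (1 - y / x)) = y * Real.exp x + x - y := by
    field_simp; ring
  rw [e] at h2
  linarith

lemma sc_prod_aux {m u : ℝ} (hm : 0 < m) (hu : 0 ≤ u) :
    (1 - Real.exp (-(m * Real.exp u))) * (1 - Real.exp (-(m * Real.exp (-u)))) ≤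
      (1 - Real.exp (-m)) ^ 2 := by
  set φ : ℝ → ℝ := fun u =>
    (1 - Real.exp (-(m * Real.exp u))) * (1 - Real.exp (-(m * Real.exp (-u)))) with hφ
  have hd : ∀ v, HasDerivAt φ
      (Real.exp (-(m * Real.exp v)) * (m * Real.exp v) * (1 - Real.exp (-(m * Real.exp (-v))))
        - (1 - Real.exp (-(m * Real.exp v))) *
          (Real.exp (-(m * Real.exp (-v))) * (m * Real.exp (-v)))) v := fun v => by
    have h1 := (((Real.hasDerivAt_exp v).const_mul m).neg.exp).const_sub 1
    have h2 := (((hasDerivAt_neg v).exp.const_mul m).neg.exp).const_sub 1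
    convert! h1.mul h2 using 1
    simp only [Pi.neg_apply]
    ring
  have hanti : AntitoneOn φ (Ici 0) := by
    refine antitoneOn_of_deriv_nonpos (convex_Ici 0)
      (fun v _ => (hd v).continuousAt.continuousWithinAt)
      (fun v _ => (hd v).differentiableAt.differentiableWithinAt) ?_
    intro v hv
    rw [interior_Ici] at hv
    have hv : 0 < v := hv
    rw [(hd v).deriv]
    have hy : 0 < m * Real.exp (-v) := by positivity
    have hxy : m * Real.exp (-v) ≤ m * Real.exp v := by
      gcongr; linarith
    generalize m * Real.exp (-v) = y at *
    generalize m * Real.exp v = x at *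
    have h := sc_exp_slope hy hxy
    have e1 : Real.exp (-x) * Real.exp x = 1 := by rw [← Real.exp_add]; simp
    have e2 : Real.exp (-y) * Real.exp y = 1 := by rw [← Real.exp_add]; simp
    have h2 := mul_le_mul_of_nonneg_left h
      (mul_pos (Real.exp_pos (-x)) (Real.exp_pos (-y))).le
    have e3 : Real.exp (-x) * Real.exp (-y) * (x * (Real.exp y - 1)) =
        Real.exp (-x) * x * (1 - Real.exp (-y)) := by
      linear_combination (Real.exp (-x) * x) * e2
    have e4 : Real.exp (-x) * Real.exp (-y) * (y * (Real.exp x - 1)) =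
        (1 - Real.exp (-x)) * (Real.exp (-y) * y) := by
      linear_combination (Real.exp (-y) * y) * e1
    linarith
  have := hanti (mem_Ici.2 le_rfl) (mem_Ici.2 hu) hu
  simp only [hφ, neg_zero, Real.exp_zero, mul_one] at this
  rw [pow_two]; exact this

lemma sc_exp_ineq {a b : ℝ} (ha : 0 ≤ a) (hb : 0 ≤ b) :
    Real.exp (-(a + b)) - Real.exp (-a) - Real.exp (-b) ≤
      Real.exp (-(2 * √(a * b))) - 2 * Real.exp (-√(a * b)) := by
  wlog hab : b ≤ a generalizing a b
  · have := this hb ha (le_of_not_ge hab)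
    rw [mul_comm b a, add_comm b a] at this
    linarith
  rcases hb.eq_or_lt with rfl | hb
  · simp; linarith
  have ha : 0 < a := hb.trans_le hab
  have hm : 0 < √(a * b) := by positivity
  have hsq : √(a * b) = √a * √b := Real.sqrt_mul ha.le b
  have h := sc_prod_aux (m := √(a * b)) (u := Real.log (√a / √b)) hm
    (Real.log_nonneg (by
      rw [one_le_div (by positivity)]; exact Real.sqrt_le_sqrt hab))
  have hsa : 0 < √a := by positivity
  have hsb : 0 < √b := by positivity
  have qa := Real.mul_self_sqrt ha.le
  have qb := Real.mul_self_sqrt hb.le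
  rw [← Real.log_inv, Real.exp_log (by positivity), Real.exp_log (by positivity), inv_div] at h
  have e1 : √(a * b) * (√a / √b) = a := by
    rw [hsq]; field_simp; nlinarith
  have e2 : √(a * b) * (√b / √a) = b := by
    rw [hsq]; field_simp; nlinarith
  rw [e1, e2] at h
  have e3 : Real.exp (-(a + b)) = Real.exp (-a) * Real.exp (-b) := by
    rw [← Real.exp_add]; ring_nf
  have e4 : Real.exp (-(2 * √(a * b))) = Real.exp (-√(a * b)) * Real.exp (-√(a * b)) := by
    rw [← Real.exp_add]; ring_nf
  rw [e3, e4]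
  nlinarith

lemma cmp_core {ι : Type*} [Fintype ι] (q c J : ℝ) (hJ : 0 < J) (S : Set ℝ)
    (hint : ∀ x ∈ S, IntegrableOn
      (fun t => (Real.exp (-(t * x)) - c + c * (t * x)) * t ^ (-q - 1)) (Ioi 0))
    (hval : ∀ x ∈ S,
      ∫ t in Ioi 0, (Real.exp (-(t * x)) - c + c * (t * x)) * t ^ (-q - 1) = x ^ q * J)
    (w x : ι → ℝ) (hx : ∀ i, x i ∈ S) (h0 : ∑ i, w i = 0) (h1 : ∑ i, w i * x i = 0)
    (he : ∀ t, 0 < t → ∑ i, w i * Real.exp (-(t * x i)) ≤ 0) :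
    ∑ i, w i * x i ^ q ≤ 0 := by
  have key : (∑ i, w i * x i ^ q) * J =
      ∫ t in Ioi 0, ∑ i, w i *
        ((Real.exp (-(t * x i)) - c + c * (t * x i)) * t ^ (-q - 1)) := by
    rw [integral_finsetSum _ (fun i _ => (hint _ (hx i)).const_mul (w i)), Finset.sum_mul]
    refine Finset.sum_congr rfl fun i _ => ?_
    rw [integral_const_mul, hval _ (hx i), mul_assoc]
  have hle : (∑ i, w i * x i ^ q) * J ≤ 0 := by
    rw [key]
    refine setIntegral_nonpos measurableSet_Ioi fun t ht => ?_
    have ht : 0 < t := ht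
    have e : ∑ i, w i * ((Real.exp (-(t * x i)) - c + c * (t * x i)) * t ^ (-q - 1)) =
        (∑ i, w i * Real.exp (-(t * x i)) - c * ∑ i, w i + c * t * ∑ i, w i * x i)
          * t ^ (-q - 1) := by
      rw [Finset.mul_sum, Finset.mul_sum, ← Finset.sum_sub_distrib, ← Finset.sum_add_distrib,
        Finset.sum_mul]
      exact Finset.sum_congr rfl fun i _ => by ring
    rw [e, h0, h1]
    have := he t ht
    refine mul_nonpos_of_nonpos_of_nonneg (by linarith) (by positivity)
  by_contra hcon
  push Not at hcon
  have := mul_pos hcon hJ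
  linarith

lemma ker_neg_int {q x : ℝ} (hq : q < 0) (hx : 0 < x) :
    ∫ t in Ioi 0, (Real.exp (-(t * x)) - 0 + 0 * (t * x)) * t ^ (-q - 1) =
      x ^ q * Real.Gamma (-q) := by
  have := Real.integral_rpow_mul_exp_neg_mul_Ioi (a := -q) (r := x) (by linarith) hx
  rw [one_div, Real.inv_rpow hx.le, Real.rpow_neg hx.le, inv_inv] at this
  rw [← this]
  congr 1; ext t
  rw [mul_comm t x]; ring

lemma ker_bound {y : ℝ} (hy : 0 ≤ y) :
    0 ≤ Real.exp (-y) - 1 + y ∧ Real.exp (-y) - 1 + y ≤ y ∧ Real.exp (-y) - 1 + y ≤ y ^ 2 := by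
  refine ⟨by linarith [Real.add_one_le_exp (-y)], by
    linarith [Real.exp_le_one_iff.2 (neg_nonpos.2 hy)], ?_⟩
  have h := Real.add_one_le_exp y
  have h2 : Real.exp (-y) * Real.exp y = 1 := by rw [← Real.exp_add]; simp
  have h3 := Real.exp_pos (-y)
  have h4 : Real.exp (-y) * (y + 1) ≤ 1 :=
    (mul_le_mul_of_nonneg_left h h3.le).trans h2.le
  by_contra hc
  push Not at hc
  have : (1 - y + y ^ 2) * (y + 1) < 1 := by
    refine lt_of_lt_of_le ?_ h4
    gcongr; linarith
  nlinarith [pow_nonneg hy 3]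

lemma ker_pos_integrable {q x : ℝ} (h1 : 1 < q) (h2 : q < 2) (hx : 0 ≤ x) :
    IntegrableOn (fun t : ℝ => (Real.exp (-(t * x)) - 1 + 1 * (t * x)) * t ^ (-q - 1))
      (Ioi 0) := by
  have hmeas : Measurable
      (fun t : ℝ => (Real.exp (-(t * x)) - 1 + 1 * (t * x)) * t ^ (-q - 1)) := by fun_prop
  rw [← Ioc_union_Ioi_eq_Ioi (zero_le_one' ℝ), integrableOn_union]
  constructor
  · have hI : IntegrableOn (fun t : ℝ => x ^ 2 * t ^ (1 - q)) (Ioc 0 1) := by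
      apply Integrable.const_mul
      exact (intervalIntegrable_iff_integrableOn_Ioc_of_le (zero_le_one' ℝ)).1
        (intervalIntegral.intervalIntegrable_rpow' (by linarith))
    refine Integrable.mono' hI hmeas.aestronglyMeasurable ?_
    refine (ae_restrict_iff' measurableSet_Ioc).2 (Eventually.of_forall fun t ht => ?_)
    have ht : 0 < t := ht.1
    obtain ⟨a, _, b⟩ := ker_bound (y := t * x) (by positivity)
    rw [one_mul, Real.norm_of_nonneg (by positivity)]
    have e : t ^ (1 - q) = t ^ 2 * t ^ (-q - 1) := by
      rw [← Real.rpow_natCast, ← Real.rpow_add ht]; congr 1; push_cast; ring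
    rw [e]
    calc _ ≤ (t * x) ^ 2 * t ^ (-q - 1) := by gcongr
      _ = _ := by ring
  · have hI : IntegrableOn (fun t : ℝ => x * t ^ (-q)) (Ioi 1) := by
      apply Integrable.const_mul
      exact integrableOn_Ioi_rpow_of_lt (by linarith) one_pos
    refine Integrable.mono' hI hmeas.aestronglyMeasurable ?_
    refine (ae_restrict_iff' measurableSet_Ioi).2 (Eventually.of_forall fun t ht => ?_)
    have ht : 0 < t := one_pos.trans ht
    obtain ⟨a, b, _⟩ := ker_bound (y := t * x) (by positivity)
    rw [one_mul, Real.norm_of_nonneg (by positivity)]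
    have e : t ^ (-q) = t * t ^ (-q - 1) := by
      rw [Real.rpow_sub_one ht.ne']; field_simp
    rw [e]
    calc _ ≤ (t * x) * t ^ (-q - 1) := by gcongr
      _ = _ := by ring

lemma ker_pos_int {q x : ℝ} (h1 : 1 < q) (hx : 0 ≤ x) :
    ∫ t in Ioi 0, (Real.exp (-(t * x)) - 1 + 1 * (t * x)) * t ^ (-q - 1) =
      x ^ q * ∫ t in Ioi 0, (Real.exp (-(t * 1)) - 1 + 1 * (t * 1)) * t ^ (-q - 1) := by
  rcases hx.eq_or_lt with rfl | hx
  · rw [Real.zero_rpow (by linarith)]; simp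
  have h := integral_comp_mul_left_Ioi
    (fun t : ℝ => (Real.exp (-(t * 1)) - 1 + 1 * (t * 1)) * t ^ (-q - 1)) 0 hx
  rw [mul_zero, smul_eq_mul] at h
  have e : x ^ q = x ^ (q + 1) * x⁻¹ := by
    rw [Real.rpow_add_one hx.ne']; field_simp
  rw [e, mul_assoc, ← h, ← integral_const_mul]
  refine setIntegral_congr_fun measurableSet_Ioi fun t ht => ?_
  have ht : 0 < t := ht
  have e2 : x ^ (q + 1) * x ^ (-q - 1) = 1 := by
    rw [← Real.rpow_add hx]; ring_nf; simp
  simp only [mul_one, one_mul]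
  rw [Real.mul_rpow hx.le ht.le, mul_comm x t]
  linear_combination (-(Real.exp (-(t * x)) - 1 + t * x) * t ^ (-q - 1)) * e2

lemma ker_pos_pos {q : ℝ} (h1 : 1 < q) (h2 : q < 2) :
    0 < ∫ t in Ioi 0, (Real.exp (-(t * 1)) - 1 + 1 * (t * 1)) * t ^ (-q - 1) := by
  have hp : ∀ t : ℝ, t ∈ Ioi (0:ℝ) →
      0 < (Real.exp (-(t * 1)) - 1 + 1 * (t * 1)) * t ^ (-q - 1) := fun t ht => by
    have ht : 0 < t := ht
    have := Real.add_one_lt_exp (x := -t) (by linarith)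
    rw [mul_one, one_mul]
    exact mul_pos (by linarith) (by positivity)
  rw [setIntegral_pos_iff_support_of_nonneg_ae
    ((ae_restrict_iff' measurableSet_Ioi).2 (Eventually.of_forall fun t ht => (hp t ht).le))
    (ker_pos_integrable h1 h2 zero_le_one)]
  have : Function.support (fun t : ℝ =>
      (Real.exp (-(t * 1)) - 1 + 1 * (t * 1)) * t ^ (-q - 1)) ∩ Ioi 0 = Ioi 0 :=
    inter_eq_right.2 fun t ht => (hp t ht).ne'
  rw [this]; simp

lemma cmp_main {ι : Type*} [Fintype ι] (q : ℝ) (w x : ι → ℝ)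
    (hq : (q < 0 ∧ ∀ i, 0 < x i) ∨ (1 ≤ q ∧ q ≤ 2 ∧ ∀ i, 0 ≤ x i))
    (h0 : ∑ i, w i = 0) (h1 : ∑ i, w i * x i = 0)
    (he : ∀ t, 0 < t → ∑ i, w i * Real.exp (-(t * x i)) ≤ 0) :
    ∑ i, w i * x i ^ q ≤ 0 := by
  have mid : ∀ q : ℝ, 1 < q → q < 2 → (∀ i, 0 ≤ x i) → ∑ i, w i * x i ^ q ≤ 0 :=
    fun q hq1 hq2 hx => cmp_core q 1 _ (ker_pos_pos hq1 hq2) (Ici 0)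
      (fun y hy => ker_pos_integrable hq1 hq2 hy) (fun y hy => ker_pos_int hq1 hy)
      w x hx h0 h1 he
  rcases hq with ⟨hq, hx⟩ | ⟨hq1, hq2, hx⟩
  · have hG : 0 < Real.Gamma (-q) := Real.Gamma_pos_of_pos (by linarith)
    refine cmp_core q 0 (Real.Gamma (-q)) hG (Ioi 0)
      (fun y hy => ?_) (fun y hy => ker_neg_int hq hy) w x hx h0 h1 he
    by_contra hc
    have := ker_neg_int hq hy
    rw [integral_undef hc] at this
    have h3 := mul_pos (Real.rpow_pos_of_pos hy q) hG
    linarith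
  · rcases hq1.eq_or_lt with rfl | hq1
    · simp [h1]
    rcases hq2.eq_or_lt with rfl | hq2
    · have ht : Tendsto (fun q : ℝ => ∑ i, w i * x i ^ q) (𝓝[<] 2)
          (𝓝 (∑ i, w i * x i ^ (2:ℝ))) := by
        refine tendsto_finsetSum _ fun i _ => Tendsto.const_mul _ ?_
        exact (Real.continuousAt_const_rpow' (by norm_num)).tendsto.mono_left nhdsWithin_le_nhds
      refine le_of_tendsto ht ?_
      filter_upwards [Ioo_mem_nhdsLT (show (1:ℝ) < 2 by norm_num)] with r hr
      exact mid r hr.1 hr.2 hx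
    · exact mid q hq1 hq2 hx

lemma sc_rpow_ineq {a b q : ℝ}
    (hq : (q < 0 ∧ 0 < a ∧ 0 < b) ∨ (1 ≤ q ∧ q ≤ 2 ∧ 0 ≤ a ∧ 0 ≤ b)) :
    (a + b) ^ q - a ^ q - b ^ q ≤ (2 ^ q - 2) * (a ^ (q / 2) * b ^ (q / 2)) := by
  have ha : 0 ≤ a := by rcases hq with h | h; exacts [h.2.1.le, h.2.2.1]
  have hb : 0 ≤ b := by rcases hq with h | h; exacts [h.2.2.le, h.2.2.2]
  have h := cmp_main q ![1, -1, -1, -1, 2] ![a + b, a, b, 2 * √(a * b), √(a * b)] (by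
      rcases hq with ⟨h1, h2, h3⟩ | ⟨h1, h2, h3, h4⟩
      · refine Or.inl ⟨h1, fun i => ?_⟩
        fin_cases i <;> simp <;> positivity
      · refine Or.inr ⟨h1, h2, fun i => ?_⟩
        fin_cases i <;> simp <;> positivity)
    (by simp [Fin.sum_univ_succ]; norm_num)
    (by simp [Fin.sum_univ_succ]; ring)
    (fun t ht => by
      have := sc_exp_ineq (a := t * a) (b := t * b) (by positivity) (by positivity)
      have e : √(t * a * (t * b)) = t * √(a * b) := by
        rw [show t * a * (t * b) = t ^ 2 * (a * b) by ring, Real.sqrt_mul (by positivity),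
          Real.sqrt_sq ht.le]
      rw [e, ← mul_add, mul_left_comm] at this
      simp [Fin.sum_univ_succ]
      linarith)
  have e : √(a * b) ^ q = a ^ (q / 2) * b ^ (q / 2) := by
    rw [Real.sqrt_eq_rpow, ← Real.rpow_mul (by positivity), Real.mul_rpow ha hb]
    congr 2 <;> ring
  simp [Fin.sum_univ_succ] at h
  rw [Real.mul_rpow (by norm_num) (by positivity), e] at h
  linarith
end Scalar

section Fin
variable {n : ℕ} {A B : Matrix (Fin n) (Fin n) ℂ}

/-- squared overlaps of the eigenvectors of `A` and `B` -/
noncomputable def overlap (hA : A.IsHermitian) (hB : B.IsHermitian) (i j : Fin n) : ℝ :=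
  Complex.normSq ((star (hA.eigenvectorUnitary : Matrix (Fin n) (Fin n) ℂ) *
    (hB.eigenvectorUnitary : Matrix (Fin n) (Fin n) ℂ)) i j)

lemma trace_cfc_eq (hA : A.IsHermitian) (f : ℝ → ℝ) :
    (cfc f A).trace = ((∑ i, f (hA.eigenvalues i) : ℝ) : ℂ) := by
  rw [hA.cfc_eq, Matrix.IsHermitian.cfc, Unitary.conjStarAlgAut_apply, Matrix.trace_mul_comm,
    ← mul_assoc, Unitary.coe_star_mul_self, one_mul, Matrix.trace_diagonal]
  simp

lemma trace_cfc_mul_eq (hA : A.IsHermitian) (hB : B.IsHermitian) (f g : ℝ → ℝ) :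
    (cfc f A * cfc g B).trace =
      ((∑ i, ∑ j, overlap hA hB i j * (f (hA.eigenvalues i) * g (hB.eigenvalues j)) : ℝ) : ℂ) := by
  rw [hA.cfc_eq, hB.cfc_eq, Matrix.IsHermitian.cfc, Matrix.IsHermitian.cfc,
    Unitary.conjStarAlgAut_apply, Unitary.conjStarAlgAut_apply]
  unfold overlap
  generalize (hA.eigenvectorUnitary : Matrix (Fin n) (Fin n) ℂ) = U
  generalize (hB.eigenvectorUnitary : Matrix (Fin n) (Fin n) ℂ) = V
  generalize hD : Matrix.diagonal ((RCLike.ofReal : ℝ → ℂ) ∘ f ∘ hA.eigenvalues) = D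
  generalize hE : Matrix.diagonal ((RCLike.ofReal : ℝ → ℂ) ∘ g ∘ hB.eigenvalues) = E
  have e : (U * D * star U * (V * E * star V)).trace =
      (D * (star U * V) * E * star (star U * V)).trace := by
    rw [show U * D * star U * (V * E * star V) = U * (D * star U * (V * E * star V)) by
      simp only [mul_assoc], Matrix.trace_mul_comm]
    simp only [star_mul, star_star, mul_assoc]
  rw [e]
  generalize star U * V = W
  subst hD hE
  rw [Matrix.trace]
  simp only [Matrix.diag_apply]
  push_cast
  refine Finset.sum_congr rfl fun i _ => ?_
  rw [Matrix.mul_apply]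
  refine Finset.sum_congr rfl fun j _ => ?_
  rw [Matrix.mul_diagonal, Matrix.diagonal_mul, Matrix.star_apply, ← Complex.mul_conj]
  simp
  ring

lemma trace_cfc_left (hA : A.IsHermitian) (hB : B.IsHermitian) (f : ℝ → ℝ) :
    (cfc f A).trace = ((∑ i, ∑ j, overlap hA hB i j * f (hA.eigenvalues i) : ℝ) : ℂ) := by
  have h := trace_cfc_mul_eq hA hB f (fun _ => 1)
  rw [cfc_const_one ℝ B hB.isSelfAdjoint, mul_one] at h
  simpa using h

lemma trace_cfc_right (hA : A.IsHermitian) (hB : B.IsHermitian) (f : ℝ → ℝ) :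
    (cfc f B).trace = ((∑ i, ∑ j, overlap hA hB i j * f (hB.eigenvalues j) : ℝ) : ℂ) := by
  have h := trace_cfc_mul_eq hA hB (fun _ => 1) f
  rw [cfc_const_one ℝ A hA.isSelfAdjoint, one_mul] at h
  simpa using h

lemma exp_eq_cfc (hA : A.IsHermitian) (t : ℝ) :
    NormedSpace.exp ((-t) • A) = cfc (fun x : ℝ => Real.exp (-(t * x))) A := by
  rw [hA.cfc_eq, Matrix.IsHermitian.cfc, Unitary.conjStarAlgAut_apply]
  conv_lhs => rw [hA.spectral_theorem, Unitary.conjStarAlgAut_apply]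
  set U := hA.eigenvectorUnitary
  have hinv : (U : Matrix (Fin n) (Fin n) ℂ)⁻¹ = star (U : Matrix (Fin n) (Fin n) ℂ) :=
    Matrix.inv_eq_left_inv (Unitary.coe_star_mul_self U)
  have hu : IsUnit (U : Matrix (Fin n) (Fin n) ℂ) := (Unitary.toUnits U).isUnit
  have h1 : (-t) • ((U : Matrix (Fin n) (Fin n) ℂ) *
      Matrix.diagonal ((RCLike.ofReal : ℝ → ℂ) ∘ hA.eigenvalues) * star (U : Matrix (Fin n) (Fin n) ℂ)) =
      (U : Matrix (Fin n) (Fin n) ℂ) *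
      Matrix.diagonal (fun i => ((-(t * hA.eigenvalues i) : ℝ) : ℂ)) *
        (U : Matrix (Fin n) (Fin n) ℂ)⁻¹ := by
    rw [hinv, ← smul_mul_assoc, ← mul_smul_comm]
    congr 2
    rw [← Matrix.diagonal_smul]
    congr 1
    ext i
    simp
  rw [h1, Matrix.exp_conj _ _ hu, Matrix.exp_diagonal, hinv]
  congr 3
  ext i
  rw [Pi.coe_exp, ← Complex.exp_eq_exp_ℂ]
  simp

lemma gt_sum (hA : A.IsHermitian) (hB : B.IsHermitian) (t : ℝ) :
    ∑ k, Real.exp (-(t * (hA.add hB).eigenvalues k)) ≤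
      ∑ i, ∑ j, overlap hA hB i j * Real.exp (-(t * (hA.eigenvalues i + hB.eigenvalues j))) := by
  have hh : ∀ X : Matrix (Fin n) (Fin n) ℂ, X.IsHermitian → ((-t) • X).IsHermitian :=
    fun X hX => by
      unfold Matrix.IsHermitian
      rw [Matrix.conjTranspose_smul, hX.eq]; simp
  have h := golden_thompson _ _ (hh A hA) (hh B hB)
  rw [← smul_add, exp_eq_cfc hA, exp_eq_cfc hB, exp_eq_cfc (hA.add hB),
    trace_cfc_eq (hA.add hB), trace_cfc_mul_eq hA hB, Complex.ofReal_re, Complex.ofReal_re] at h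
  refine h.trans (le_of_eq ?_)
  refine Finset.sum_congr rfl fun i _ => Finset.sum_congr rfl fun j _ => ?_
  rw [← Real.exp_add]
  ring_nf

lemma rpow_sum (hA : A.IsHermitian) (hB : B.IsHermitian) (q : ℝ)
    (hq : (q < 0 ∧ (∀ k, 0 < (hA.add hB).eigenvalues k) ∧
        ∀ i j, 0 < hA.eigenvalues i + hB.eigenvalues j) ∨
      (1 ≤ q ∧ q ≤ 2 ∧ (∀ k, 0 ≤ (hA.add hB).eigenvalues k) ∧
        ∀ i j, 0 ≤ hA.eigenvalues i + hB.eigenvalues j)) :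
    ∑ k, (hA.add hB).eigenvalues k ^ q ≤
      ∑ i, ∑ j, overlap hA hB i j * (hA.eigenvalues i + hB.eigenvalues j) ^ q := by
  have h := cmp_main q (ι := Fin n ⊕ (Fin n × Fin n))
    (Sum.elim (fun _ => 1) (fun p => - overlap hA hB p.1 p.2))
    (Sum.elim (fun k => (hA.add hB).eigenvalues k)
      (fun p => hA.eigenvalues p.1 + hB.eigenvalues p.2))
    (by
      rcases hq with ⟨h1, h2, h3⟩ | ⟨h1, h2, h3, h4⟩
      · refine Or.inl ⟨h1, ?_⟩
        rintro (k | p)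
        · exact h2 k
        · exact h3 p.1 p.2
      · refine Or.inr ⟨h1, h2, ?_⟩
        rintro (k | p)
        · exact h3 k
        · exact h4 p.1 p.2)
    (by
      have e1 := trace_cfc_eq hA (fun _ => 1)
      rw [trace_cfc_left hA hB] at e1
      have e1 := Complex.ofReal_injective e1
      simp only [Fintype.sum_sum_type, Sum.elim_inl, Sum.elim_inr, Fintype.sum_prod_type,
        Finset.sum_neg_distrib]
      simp only [mul_one] at e1
      linarith)
    (by
      have e1 := trace_cfc_left hA hB id
      have e2 := trace_cfc_right hA hB id
      have e3 := trace_cfc_eq (hA.add hB) id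
      rw [cfc_id ℝ _ hA.isSelfAdjoint] at e1
      rw [cfc_id ℝ _ hB.isSelfAdjoint] at e2
      rw [cfc_id ℝ _ (hA.add hB).isSelfAdjoint, Matrix.trace_add, e1, e2,
        ← Complex.ofReal_add] at e3
      have e3 := Complex.ofReal_injective e3
      simp only [Fintype.sum_sum_type, Sum.elim_inl, Sum.elim_inr, Fintype.sum_prod_type,
        neg_mul, one_mul, Finset.sum_neg_distrib, mul_add, Finset.sum_add_distrib]
      simp only [id] at e3
      linarith)
    (fun t ht => by
      have := gt_sum hA hB t
      simp only [Fintype.sum_sum_type, Sum.elim_inl, Sum.elim_inr, Fintype.sum_prod_type,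
        neg_mul, one_mul, Finset.sum_neg_distrib]
      linarith)
  simp only [Fintype.sum_sum_type, Sum.elim_inl, Sum.elim_inr, Fintype.sum_prod_type,
        neg_mul, one_mul, Finset.sum_neg_distrib] at h
  linarith

end Fin

/-- Corollary 4.1, second part: if either `q < 0` and `A, B` are positive definite, or
`1 ≤ q ≤ 2` and `A, B` are positive semidefinite, then
`Tr((A+B)^q) - Tr(A^q) - Tr(B^q) ≤ (2^q - 2)·Tr(A^{q/2}·B^{q/2})`. -/
theorem trace_rpow_inequality_reversed {n : ℕ}
    (A B : Matrix (Fin n) (Fin n) ℂ) (q : ℝ)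
    (hq : (q < 0 ∧ A.PosDef ∧ B.PosDef) ∨ (1 ≤ q ∧ q ≤ 2 ∧ A.PosSemidef ∧ B.PosSemidef)) :
    (matrixRpow (A + B) q).trace - (matrixRpow A q).trace - (matrixRpow B q).trace ≤
      ((2 ^ q - 2 : ℝ) : ℂ) * (matrixRpow A (q / 2) * matrixRpow B (q / 2)).trace := by
  have hA : A.IsHermitian := by
    rcases hq with h | h; exacts [h.2.1.isHermitian, h.2.2.1.isHermitian]
  have hB : B.IsHermitian := by
    rcases hq with h | h; exacts [h.2.2.isHermitian, h.2.2.2.isHermitian]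
  have hsum := rpow_sum hA hB q (by
    rcases hq with ⟨h1, h2, h3⟩ | ⟨h1, h2, h3, h4⟩
    · exact Or.inl ⟨h1, fun k => (h2.add h3).eigenvalues_pos k,
        fun i j => add_pos (h2.eigenvalues_pos i) (h3.eigenvalues_pos j)⟩
    · exact Or.inr ⟨h1, h2, fun k => (h3.add h4).eigenvalues_nonneg k,
        fun i j => add_nonneg (h3.eigenvalues_nonneg i) (h4.eigenvalues_nonneg j)⟩)
  unfold matrixRpow
  rw [trace_cfc_eq (hA.add hB), trace_cfc_left hA hB, trace_cfc_right hA hB,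
    trace_cfc_mul_eq hA hB, ← Complex.ofReal_sub, ← Complex.ofReal_sub, ← Complex.ofReal_mul,
    Complex.real_le_real]
  have hs : ∑ i, ∑ j, overlap hA hB i j * ((hA.eigenvalues i + hB.eigenvalues j) ^ q -
      hA.eigenvalues i ^ q - hB.eigenvalues j ^ q) ≤
      ∑ i, ∑ j, overlap hA hB i j * ((2 ^ q - 2) *
        (hA.eigenvalues i ^ (q / 2) * hB.eigenvalues j ^ (q / 2))) := by
    refine Finset.sum_le_sum fun i _ => Finset.sum_le_sum fun j _ => ?_
    refine mul_le_mul_of_nonneg_left (sc_rpow_ineq ?_) (Complex.normSq_nonneg _)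
    rcases hq with ⟨h1, h2, h3⟩ | ⟨h1, h2, h3, h4⟩
    · exact Or.inl ⟨h1, h2.eigenvalues_pos i, h3.eigenvalues_pos j⟩
    · exact Or.inr ⟨h1, h2, h3.eigenvalues_nonneg i, h4.eigenvalues_nonneg j⟩
  have e : ∑ i, ∑ j, overlap hA hB i j * ((2 ^ q - 2) *
        (hA.eigenvalues i ^ (q / 2) * hB.eigenvalues j ^ (q / 2))) =
      (2 ^ q - 2) * ∑ i, ∑ j, overlap hA hB i j *
        (hA.eigenvalues i ^ (q / 2) * hB.eigenvalues j ^ (q / 2)) := by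
    simp only [Finset.mul_sum]
    refine Finset.sum_congr rfl fun i _ => Finset.sum_congr rfl fun j _ => by ring
  rw [e] at hs
  simp only [mul_sub, Finset.sum_sub_distrib] at hs
  linarith
end
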